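/- For every r > 2 there is a constant C depending only on r such that the following holds for all ε ∈ (0,1], t ∈ [0,ε], τ > 0. Let w̄ = (w̄_ξ)_{ξ∈ℝ} be a family of continuously differentiable functions w̄_ξ : [0,∞) → ℂ with w̄_ξ(0) = 0, for which all norms below are finite and all integrals converge absolutely. Define 𝒩_ξ(y) = i∫_ℝ ( w̄_η(y)(ξ−η)w̄_{ξ−η}(y) − η I_y[w̄_η] ∂_y w̄_{ξ−η}(y) ) dη and T_𝒩 = ∫_ℝ∫_0^∞ 𝒩_ξ(y) conj(w̄_ξ(y)) ρ(y)² e^{2τ|ξ|} ⟨ξ⟩^{2r} dy dξ. Then |T_𝒩| ≤ C ‖|∂ₓ|^{1/2} w̄‖_{τ,r} ‖⟨∂ₓ⟩^{1/2} w̄‖_{τ,r} ‖∂_y w̄‖_{τ,r}. -/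

import Mathlib

open MeasureTheory Set Filter

noncomputable section

/-- Gaussian weight `ρ(y) = exp(y²/(8(1+t/ε)))`. -/
def rho (ε t y : ℝ) : ℝ := Real.exp (y ^ 2 / (8 * (1 + t / ε)))

/-- Japanese bracket `⟨ξ⟩ = √(1+ξ²)`. -/
def brak (ξ : ℝ) : ℝ := Real.sqrt (1 + ξ ^ 2)

/-- Combined weight `ρ(y)² e^{2τ|ξ|} ⟨ξ⟩^{2s}` in the squared analytic norms. -/
def wgt (ε t τ s ξ y : ℝ) : ℝ :=
  (rho ε t y) ^ 2 * Real.exp (2 * τ * |ξ|) * brak ξ ^ (2 * s)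

/-- Weight `e^{2τ|ξ|} ⟨ξ⟩^{2s}` for the squared analytic norms of boundary data. -/
def aWgt (τ s ξ : ℝ) : ℝ := Real.exp (2 * τ * |ξ|) * brak ξ ^ (2 * s)

/-- Analytic norm `‖w‖_{τ,s}` (with Fourier multiplier `m`):
`(∫_ℝ ∫_0^∞ m(ξ) ρ(y)² |w_ξ(y)|² e^{2τ|ξ|} ⟨ξ⟩^{2s} dy dξ)^{1/2}`. -/
def wNorm (ε t τ s : ℝ) (m : ℝ → ℝ) (w : ℝ → ℝ → ℂ) : ℝ :=
  Real.sqrt (∫ ξ : ℝ, ∫ y in Ioi (0 : ℝ), m ξ * ‖w ξ y‖ ^ 2 * wgt ε t τ s ξ y)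

/-- Analytic norm `‖A‖~_{τ,s}` (with Fourier multiplier `m`):
`(∫_ℝ m(ξ) |A_ξ|² e^{2τ|ξ|} ⟨ξ⟩^{2s} dξ)^{1/2}`. -/
def aNorm (τ s : ℝ) (m : ℝ → ℝ) (A : ℝ → ℂ) : ℝ :=
  Real.sqrt (∫ ξ : ℝ, m ξ * ‖A ξ‖ ^ 2 * aWgt τ s ξ)

/-- Finiteness of the squared norm `‖·‖_{τ,s}` with multiplier `m`. -/
def wFinite (ε t τ s : ℝ) (m : ℝ → ℝ) (w : ℝ → ℝ → ℂ) : Prop :=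
  Integrable (fun p : ℝ × ℝ => m p.1 * ‖w p.1 p.2‖ ^ 2 * wgt ε t τ s p.1 p.2)
    ((volume : Measure ℝ).prod ((volume : Measure ℝ).restrict (Ioi 0)))

/-- Finiteness of the squared norm `‖·‖~_{τ,s}` with multiplier `m`. -/
def aFinite (τ s : ℝ) (m : ℝ → ℝ) (A : ℝ → ℂ) : Prop :=
  Integrable (fun ξ : ℝ => m ξ * ‖A ξ‖ ^ 2 * aWgt τ s ξ) (volume : Measure ℝ)

/-- `I_y[h] = ∫_0^y h`. -/
def Iy (h : ℝ → ℂ) (y : ℝ) : ℂ := ∫ y' in (0 : ℝ)..y, h y'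

/-- The quadratic term `𝒩_ξ(w̄,w̄)(y) = i∫ (w̄_η (ξ−η) w̄_{ξ−η} − η I_y[w̄_η] ∂_y w̄_{ξ−η}) dη`. -/
def Ncal (w : ℝ → ℝ → ℂ) (ξ y : ℝ) : ℂ :=
  Complex.I * ∫ η : ℝ,
    (w η y * ((ξ - η : ℝ) : ℂ) * w (ξ - η) y - (η : ℂ) * Iy (w η) y * deriv (w (ξ - η)) y)

/-- `L²` norm as a lower integral. -/
def l2 {α : Type*} [MeasurableSpace α] (μ : Measure α) (f : α → ENNReal) : ENNReal :=
  (∫⁻ x, f x ^ (2 : ℝ) ∂μ) ^ (1 / 2 : ℝ)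

lemma cs {α : Type*} [MeasurableSpace α] (μ : Measure α) {f g : α → ENNReal}
    (hf : AEMeasurable f μ) (hg : AEMeasurable g μ) :
    ∫⁻ x, f x * g x ∂μ ≤ l2 μ f * l2 μ g := by
  have := ENNReal.lintegral_mul_le_Lp_mul_Lq μ (p := 2) (q := 2)
    Real.HolderConjugate.two_two hf hg
  simpa [l2] using this

/-- weighted `L²` norm in `y`. -/
def nrm (ε t : ℝ) (h : ℝ → ℂ) : ENNReal :=
  l2 ((volume : Measure ℝ).restrict (Ioi 0)) (fun y => ‖h y‖ₑ * ENNReal.ofReal (rho ε t y))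

lemma rho_pos (ε t y : ℝ) : 0 < rho ε t y := Real.exp_pos _

lemma rho_cont (ε t : ℝ) : Continuous (rho ε t) := by
  unfold rho; fun_prop

lemma brak_one_le (ξ : ℝ) : 1 ≤ brak ξ := by
  unfold brak
  rw [Real.one_le_sqrt]; nlinarith [sq_nonneg ξ]

lemma brak_pos (ξ : ℝ) : 0 < brak ξ := lt_of_lt_of_le one_pos (brak_one_le ξ)

lemma brak_cont : Continuous brak := by unfold brak; fun_prop

lemma abs_le_brak (ξ : ℝ) : |ξ| ≤ brak ξ := by
  unfold brak
  apply Real.abs_le_sqrt; linarith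

lemma brak_neg (ξ : ℝ) : brak (-ξ) = brak ξ := by simp [brak]

lemma brak_add_le (a b : ℝ) : brak (a + b) ≤ brak a + brak b := by
  have ha := abs_le_brak a
  have hb := abs_le_brak b
  have h1 : brak a ^ 2 = 1 + a ^ 2 := by unfold brak; rw [Real.sq_sqrt]; positivity
  have h2 : brak b ^ 2 = 1 + b ^ 2 := by unfold brak; rw [Real.sq_sqrt]; positivity
  have hab : a * b ≤ brak a * brak b := by
    calc a * b ≤ |a * b| := le_abs_self _
      _ = |a| * |b| := abs_mul _ _
      _ ≤ _ := mul_le_mul ha hb (abs_nonneg _) (brak_pos a).le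
  conv_lhs => unfold brak
  rw [Real.sqrt_le_left (by have := brak_pos a; have := brak_pos b; positivity)]
  nlinarith

/-- The Gaussian constant. -/
def kG : ENNReal := l2 ((volume : Measure ℝ).restrict (Ioi 0))
  (fun y => ENNReal.ofReal (Real.exp (-(1 / 16) * y ^ 2)))

lemma kG_lt_top : kG < ⊤ := by
  unfold kG l2
  apply ENNReal.rpow_lt_top_of_nonneg (by norm_num)
  have h := (integrable_exp_neg_mul_sq (b := 1 / 8) (by norm_num)).restrict (s := Ioi 0)
  have h2 := h.lintegral_lt_top
  refine ne_of_lt (lt_of_le_of_lt (le_of_eq ?_) h2)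
  apply lintegral_congr
  intro y
  rw [ENNReal.ofReal_rpow_of_nonneg (Real.exp_pos _).le (by norm_num), ← Real.exp_mul]
  congr 2; ring

lemma l1_le (ε t : ℝ) (hε : 0 < ε) (ht : 0 ≤ t) (hte : t ≤ ε) (h : ℝ → ℂ)
    (hm : AEStronglyMeasurable h ((volume : Measure ℝ).restrict (Ioi 0))) :
    ∫⁻ y in Ioi (0 : ℝ), ‖h y‖ₑ ≤ kG * nrm ε t h := by
  have hc := cs ((volume : Measure ℝ).restrict (Ioi 0))
    (f := fun y => ENNReal.ofReal (Real.exp (-(1 / 16) * y ^ 2)))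
    (g := fun y => ‖h y‖ₑ * ENNReal.ofReal (rho ε t y)) (by fun_prop)
    (hm.enorm.mul (rho_cont ε t).measurable.ennreal_ofReal.aemeasurable)
  refine le_trans (lintegral_mono fun y => ?_) hc
  have h1 : 1 ≤ Real.exp (-(1 / 16) * y ^ 2) * rho ε t y := by
    unfold rho
    rw [← Real.exp_add]
    apply Real.one_le_exp
    have h2 : t / ε ≤ 1 := by rw [div_le_one hε]; exact hte
    have h3 : 0 ≤ t / ε := by positivity
    have : y ^ 2 / 16 ≤ y ^ 2 / (8 * (1 + t / ε)) := by
      apply div_le_div_of_nonneg_left <;> first | positivity | linarith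
    linarith
  calc ‖h y‖ₑ = ‖h y‖ₑ * 1 := (mul_one _).symm
    _ ≤ ‖h y‖ₑ * ENNReal.ofReal (Real.exp (-(1 / 16) * y ^ 2) * rho ε t y) := by
        gcongr; simpa using h1
    _ = _ := by
        rw [ENNReal.ofReal_mul (Real.exp_pos _).le]; ring

lemma prim_le (h : ℝ → ℂ) (y : ℝ) (hy : 0 ≤ y) :
    ‖∫ s in (0 : ℝ)..y, h s‖ₑ ≤ ∫⁻ s in Ioi (0 : ℝ), ‖h s‖ₑ := by
  rw [intervalIntegral.integral_of_le hy]
  exact (enorm_integral_le_lintegral_enorm _).trans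
    (lintegral_mono_set (fun x hx => hx.1))

lemma sup_le_deriv (f : ℝ → ℂ) (hf : ContDiffOn ℝ 1 f (Ici 0)) (h0 : f 0 = 0) (y : ℝ) (hy : 0 ≤ y) :
    ‖f y‖ₑ ≤ ∫⁻ s in Ioi (0 : ℝ), ‖deriv f s‖ₑ := by
  have := intervalIntegral.integral_deriv_of_contDiffOn_Icc
    (hf.mono (fun x hx => hx.1 : Icc 0 y ⊆ Ici 0)) hy
  rw [h0, sub_zero] at this
  rw [← this]
  exact prim_le _ y hy

/-- The weighted `y`-norm at frequency `ξ`. -/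
def pm (ε t τ r ξ m : ℝ) (h : ℝ → ℂ) : ENNReal :=
  (∫⁻ y in Ioi (0 : ℝ), ENNReal.ofReal (m * ‖h y‖ ^ 2 * wgt ε t τ r ξ y)) ^ (1 / 2 : ℝ)

lemma pm_eq (ε t τ r ξ m : ℝ) (hm : 0 ≤ m) (h : ℝ → ℂ) :
    pm ε t τ r ξ m h =
      ENNReal.ofReal (Real.sqrt m * Real.exp (τ * |ξ|) * brak ξ ^ r) * nrm ε t h := by
  have hb := brak_pos ξ
  set c : ℝ := Real.sqrt m * Real.exp (τ * |ξ|) * brak ξ ^ r with hc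
  have hc0 : 0 ≤ c := by positivity
  have hc2 : c ^ 2 = m * Real.exp (2 * τ * |ξ|) * brak ξ ^ (2 * r) := by
    rw [hc, mul_pow, mul_pow, Real.sq_sqrt hm, ← Real.exp_nat_mul, ← Real.rpow_natCast,
      ← Real.rpow_mul hb.le]
    push_cast
    rw [mul_comm r 2, mul_assoc 2 τ]
  have hpt : ∀ y, ENNReal.ofReal (m * ‖h y‖ ^ 2 * wgt ε t τ r ξ y) =
      ENNReal.ofReal c ^ (2 : ℝ) * (‖h y‖ₑ * ENNReal.ofReal (rho ε t y)) ^ (2 : ℝ) := by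
    intro y
    rw [← ofReal_norm, ← ENNReal.ofReal_mul (norm_nonneg _),
      ENNReal.ofReal_rpow_of_nonneg hc0 (by norm_num),
      ENNReal.ofReal_rpow_of_nonneg (mul_nonneg (norm_nonneg _) (rho_pos _ _ _).le) (by norm_num),
      ← ENNReal.ofReal_mul (by positivity)]
    congr 1
    rw [Real.rpow_two, Real.rpow_two, hc2]
    unfold wgt; ring
  unfold pm nrm l2
  simp_rw [hpt]
  rw [lintegral_const_mul' _ _ (by finiteness), ENNReal.mul_rpow_of_nonneg _ _ (by norm_num),
    ← ENNReal.rpow_mul]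
  norm_num

lemma ker (r τ η ζ : ℝ) (hr : 2 < r) (hτ : 0 < τ) :
    |η| * (Real.exp (2 * τ * |η + ζ|) * brak (η + ζ) ^ (2 * r)) ≤
      (2 ^ r * 2) * ((brak η ^ (1 / 2 - r) + brak ζ ^ (1 / 2 - r)) *
        (Real.sqrt |η| * Real.exp (τ * |η|) * brak η ^ r) *
        (Real.sqrt 1 * Real.exp (τ * |ζ|) * brak ζ ^ r) *
        (Real.sqrt (brak (η + ζ)) * Real.exp (τ * |η + ζ|) * brak (η + ζ) ^ r)) := by
  have ha := brak_pos η
  have hb := brak_pos ζ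
  have hx := brak_pos (η + ζ)
  have ha1 := brak_one_le η
  have hb1 := brak_one_le ζ
  have hx1 := brak_one_le (η + ζ)
  have hadd := brak_add_le η ζ
  have habs := abs_le_brak η
  have hadd' : brak η ≤ brak (η + ζ) + brak ζ := by
    have := brak_add_le (η + ζ) (-ζ)
    rw [brak_neg] at this; simpa using this
  have hexp : Real.exp (τ * |η + ζ|) ≤ Real.exp (τ * |η|) * Real.exp (τ * |ζ|) := by
    rw [← Real.exp_add, ← mul_add]
    gcongr; exact abs_add_le _ _
  have e2 : Real.exp (2 * τ * |η + ζ|) = Real.exp (τ * |η + ζ|) * Real.exp (τ * |η + ζ|) := by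
    rw [← Real.exp_add]; congr 1; ring
  have b2 : brak (η + ζ) ^ (2 * r) = brak (η + ζ) ^ r * brak (η + ζ) ^ r := by
    rw [← Real.rpow_add hx]; congr 1; ring
  have hA : brak η ^ (1 / 2 - r) * brak η ^ r = Real.sqrt (brak η) := by
    rw [← Real.rpow_add ha, Real.sqrt_eq_rpow]; congr 1; ring
  have hB : brak ζ ^ (1 / 2 - r) * brak ζ ^ r = Real.sqrt (brak ζ) := by
    rw [← Real.rpow_add hb, Real.sqrt_eq_rpow]; congr 1; ring
  have h2r : (0 : ℝ) < 2 ^ r := by positivity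
  have key : Real.sqrt |η| * brak (η + ζ) ^ r ≤ (2 ^ r * 2) *
      ((Real.sqrt (brak η) * brak ζ ^ r + Real.sqrt (brak ζ) * brak η ^ r) *
        Real.sqrt (brak (η + ζ))) := by
    have hs1 : 1 ≤ Real.sqrt (brak (η + ζ)) := by rwa [Real.one_le_sqrt]
    rcases le_total (brak η) (brak ζ) with hle | hle
    · have h1 : brak (η + ζ) ^ r ≤ 2 ^ r * brak ζ ^ r := by
        rw [← Real.mul_rpow (by norm_num) hb.le]
        apply Real.rpow_le_rpow hx.le _ (by linarith)
        linarith
      have h2 : Real.sqrt |η| ≤ Real.sqrt (brak η) := Real.sqrt_le_sqrt habs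
      calc _ ≤ Real.sqrt (brak η) * (2 ^ r * brak ζ ^ r) := by gcongr
        _ = 2 ^ r * 1 * ((Real.sqrt (brak η) * brak ζ ^ r + 0) * 1) := by ring
        _ ≤ _ := by gcongr <;> first | positivity | norm_num
    · have h1 : brak (η + ζ) ^ r ≤ 2 ^ r * brak η ^ r := by
        rw [← Real.mul_rpow (by norm_num) ha.le]
        apply Real.rpow_le_rpow hx.le _ (by linarith)
        linarith
      have h2 : Real.sqrt |η| ≤ 2 * (Real.sqrt (brak ζ) * Real.sqrt (brak (η + ζ))) := by
        rw [← Real.sqrt_mul hb.le, Real.sqrt_le_left (by positivity), mul_pow, Real.sq_sqrt (by positivity)]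
        nlinarith
      calc _ ≤ 2 * (Real.sqrt (brak ζ) * Real.sqrt (brak (η + ζ))) * (2 ^ r * brak η ^ r) := by
            gcongr
        _ = 2 ^ r * 2 * ((0 + Real.sqrt (brak ζ) * brak η ^ r) * Real.sqrt (brak (η + ζ))) := by ring
        _ ≤ _ := by gcongr; positivity
  have hη : |η| = Real.sqrt |η| * Real.sqrt |η| := (Real.mul_self_sqrt (abs_nonneg _)).symm
  calc |η| * (Real.exp (2 * τ * |η + ζ|) * brak (η + ζ) ^ (2 * r))
      = Real.sqrt |η| * Real.exp (τ * |η + ζ|) * brak (η + ζ) ^ r *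
        (Real.exp (τ * |η + ζ|) * (Real.sqrt |η| * brak (η + ζ) ^ r)) := by
        rw [e2, b2]; nth_rewrite 1 [hη]; ring
    _ ≤ Real.sqrt |η| * Real.exp (τ * |η + ζ|) * brak (η + ζ) ^ r *
        ((Real.exp (τ * |η|) * Real.exp (τ * |ζ|)) * ((2 ^ r * 2) *
      ((Real.sqrt (brak η) * brak ζ ^ r + Real.sqrt (brak ζ) * brak η ^ r) *
        Real.sqrt (brak (η + ζ))))) := by gcongr
    _ = _ := by
        rw [← hA, ← hB, Real.sqrt_one]; ring

lemma conv_le {f g h : ℝ → ENNReal} (hf : AEMeasurable f volume) (hg : AEMeasurable g volume)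
    (hh : AEMeasurable h volume) :
    ∫⁻ ξ : ℝ, ∫⁻ η : ℝ, f η * g (ξ - η) * h ξ ≤
      (∫⁻ η, f η) * (l2 volume g * l2 volume h) := by
  have hq := quasiMeasurePreserving_sub_of_right_invariant (volume : Measure ℝ) (volume : Measure ℝ)
  have hg2 : AEMeasurable (fun p : ℝ × ℝ => g (p.1 - p.2)) (volume.prod volume) :=
    hg.comp_quasiMeasurePreserving hq
  have hgs : ∀ η, AEMeasurable (fun ξ => g (ξ - η)) volume := fun η =>
    hg.comp_quasiMeasurePreserving (measurePreserving_sub_right volume η).quasiMeasurePreserving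
  rw [lintegral_lintegral_swap]
  · rw [← lintegral_mul_const'' _ hf]
    apply lintegral_mono
    intro η
    simp only [mul_assoc]
    have hm : AEMeasurable (fun x => g (x - η) * h x) volume := (hgs η).mul hh
    rw [lintegral_const_mul'' _ hm]
    gcongr
    refine (cs _ (hgs η) hh).trans (le_of_eq ?_)
    congr 1
    unfold l2
    rw [lintegral_sub_right_eq_self (fun x => g x ^ (2 : ℝ))]
  · exact (((hf.comp_snd).mul hg2).mul hh.comp_fst)

/-- Frequency weight. -/
def jw (r ξ : ℝ) : ENNReal := ENNReal.ofReal (brak ξ ^ (1 / 2 - r))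

lemma jw_meas (r : ℝ) : Measurable (jw r) := by
  unfold jw
  exact (brak_cont.measurable.pow_const _).ennreal_ofReal

lemma jw_l2 (r : ℝ) (hr : 2 < r) : l2 volume (jw r) < ⊤ := by
  unfold l2
  apply ENNReal.rpow_lt_top_of_nonneg (by norm_num)
  have h := integrable_rpow_neg_one_add_norm_sq (E := ℝ) (μ := volume) (r := 2 * r - 1)
    (by simp; linarith)
  refine ne_of_lt (lt_of_le_of_lt (le_of_eq ?_) h.lintegral_lt_top)
  apply lintegral_congr
  intro y
  unfold jw brak
  rw [ENNReal.ofReal_rpow_of_nonneg (by positivity) (by norm_num), Real.sqrt_eq_rpow,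
    ← Real.rpow_mul (by positivity), ← Real.rpow_mul (by positivity), Real.norm_eq_abs, sq_abs]
  congr 2; ring

lemma wfin (ε t τ r : ℝ) (m : ℝ → ℝ) (hm : ∀ ξ, 0 ≤ m ξ) (w : ℝ → ℝ → ℂ)
    (h : wFinite ε t τ r m w) :
    AEMeasurable (fun ξ => pm ε t τ r ξ (m ξ) (w ξ)) volume ∧
    l2 volume (fun ξ => pm ε t τ r ξ (m ξ) (w ξ)) = ENNReal.ofReal (wNorm ε t τ r m w) := by
  have hI := h
  unfold wFinite at h
  have h1 := h.aestronglyMeasurable.aemeasurable.ennreal_ofReal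
  have hw : ∀ p : ℝ × ℝ, 0 ≤ m p.1 * ‖w p.1 p.2‖ ^ 2 * wgt ε t τ r p.1 p.2 := by
    intro p
    have := hm p.1
    have := brak_pos p.1
    unfold wgt; positivity
  refine ⟨?_, ?_⟩
  · exact h1.lintegral_prod_right'.pow_const _
  · have h2 := integral_prod _ h
    have h3 := ofReal_integral_eq_lintegral_ofReal h (Eventually.of_forall hw)
    rw [lintegral_prod _ h1, h2] at h3
    unfold wNorm
    rw [Real.sqrt_eq_rpow, ← ENNReal.ofReal_rpow_of_nonneg _ (by norm_num), h3]
    · unfold l2 pm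
      congr 1
      apply lintegral_congr
      intro ξ
      rw [← ENNReal.rpow_mul]; norm_num
    · rw [← h2]; exact integral_nonneg hw

/-- The trilinear pointwise majorant. -/
def Hk (ε t τ r : ℝ) (w : ℝ → ℝ → ℂ) (ξ η : ℝ) : ENNReal :=
  (jw r η + jw r (ξ - η)) * pm ε t τ r η |η| (w η) *
    pm ε t τ r (ξ - η) 1 (fun y => deriv (w (ξ - η)) y) * pm ε t τ r ξ (brak ξ) (w ξ)

lemma kerE (ε t τ r : ℝ) (hr : 2 < r) (hτ : 0 < τ) (w : ℝ → ℝ → ℂ) (ξ η : ℝ) :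
    ENNReal.ofReal (|η| * (Real.exp (2 * τ * |ξ|) * brak ξ ^ (2 * r))) *
      (nrm ε t (w η) * nrm ε t (fun y => deriv (w (ξ - η)) y) * nrm ε t (w ξ)) ≤
    ENNReal.ofReal (2 ^ r * 2) * Hk ε t τ r w ξ η := by
  have hk := ker r τ η (ξ - η) hr hτ
  rw [add_sub_cancel] at hk
  have hk' := ENNReal.ofReal_le_ofReal hk
  have ha := brak_pos η
  have hb := brak_pos (ξ - η)
  have hx := brak_pos ξ
  rw [ENNReal.ofReal_mul (p := 2 ^ r * 2) (by positivity),
    ENNReal.ofReal_mul (q := Real.sqrt (brak ξ) * Real.exp (τ * |ξ|) * brak ξ ^ r) (by positivity),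
    ENNReal.ofReal_mul (q := Real.sqrt 1 * Real.exp (τ * |ξ - η|) * brak (ξ - η) ^ r)
      (by positivity),
    ENNReal.ofReal_mul (q := Real.sqrt |η| * Real.exp (τ * |η|) * brak η ^ r) (by positivity),
    ENNReal.ofReal_add (by positivity) (by positivity)] at hk'
  unfold Hk
  rw [pm_eq _ _ _ _ _ _ (abs_nonneg _), pm_eq _ _ _ _ _ _ zero_le_one, pm_eq _ _ _ _ _ _ hx.le]
  unfold jw
  refine (mul_le_mul_left hk' _).trans (le_of_eq ?_)
  ring

lemma yint (ε t τ r : ℝ) (hε : 0 < ε) (ht : 0 ≤ t) (hte : t ≤ ε) (w : ℝ → ℝ → ℂ)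
    (hw : ∀ ξ : ℝ, ContDiffOn ℝ 1 (w ξ) (Ici 0)) (h0 : ∀ ξ : ℝ, w ξ 0 = 0) (ξ η : ℝ) :
    ∫⁻ y in Ioi (0 : ℝ), ‖(w η y * ((ξ - η : ℝ) : ℂ) * w (ξ - η) y
            - (η : ℂ) * Iy (w η) y * deriv (w (ξ - η)) y) *
          (starRingEnd ℂ) (w ξ y) * ((wgt ε t τ r ξ y : ℝ) : ℂ)‖ₑ ≤
    kG * (ENNReal.ofReal (|ξ - η| * (Real.exp (2 * τ * |ξ|) * brak ξ ^ (2 * r))) *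
      (nrm ε t (w (ξ - η)) * nrm ε t (fun y => deriv (w η) y) * nrm ε t (w ξ))) +
    kG * (ENNReal.ofReal (|η| * (Real.exp (2 * τ * |ξ|) * brak ξ ^ (2 * r))) *
      (nrm ε t (w η) * nrm ε t (fun y => deriv (w (ξ - η)) y) * nrm ε t (w ξ))) := by
  have hwm : ∀ ξ, AEStronglyMeasurable (w ξ) ((volume : Measure ℝ).restrict (Ioi 0)) := fun ξ =>
    ((hw ξ).continuousOn.mono Ioi_subset_Ici_self).aestronglyMeasurable measurableSet_Ioi
  have hdm : ∀ ξ, AEStronglyMeasurable (fun y => deriv (w ξ) y)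
      ((volume : Measure ℝ).restrict (Ioi 0)) := fun ξ =>
    (((hw ξ).mono Ioi_subset_Ici_self).continuousOn_deriv_of_isOpen isOpen_Ioi
      le_rfl).aestronglyMeasurable measurableSet_Ioi
  have hρm : AEMeasurable (fun y => ENNReal.ofReal (rho ε t y))
      ((volume : Measure ℝ).restrict (Ioi 0)) :=
    (rho_cont ε t).measurable.ennreal_ofReal.aemeasurable
  have hx := brak_pos ξ
  set W : ℝ := Real.exp (2 * τ * |ξ|) * brak ξ ^ (2 * r) with hW
  have hW0 : 0 ≤ W := by positivity
  set S1 := kG * nrm ε t (fun y => deriv (w η) y) with hS1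
  set S2 := kG * nrm ε t (w η) with hS2
  have hb1 : ∀ y, 0 ≤ y → ‖w η y‖ₑ ≤ S1 := fun y hy =>
    (sup_le_deriv _ (hw η) (h0 η) y hy).trans (l1_le ε t hε ht hte _ (hdm η))
  have hb2 : ∀ y, 0 ≤ y → ‖Iy (w η) y‖ₑ ≤ S2 := fun y hy =>
    (prim_le _ y hy).trans (l1_le ε t hε ht hte _ (hwm η))
  have m1 : ∀ h : ℝ → ℂ, AEStronglyMeasurable h ((volume : Measure ℝ).restrict (Ioi 0)) →
      AEMeasurable (fun y => ‖h y‖ₑ * ENNReal.ofReal (rho ε t y))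
        ((volume : Measure ℝ).restrict (Ioi 0)) := fun h hh => hh.enorm.mul hρm
  have hA := cs _ (m1 _ (hwm (ξ - η))) (m1 _ (hwm ξ))
  have hB := cs _ (m1 _ (hdm (ξ - η))) (m1 _ (hwm ξ))
  have mA : AEMeasurable (fun y => (‖w (ξ - η) y‖ₑ * ENNReal.ofReal (rho ε t y)) *
      (‖w ξ y‖ₑ * ENNReal.ofReal (rho ε t y))) ((volume : Measure ℝ).restrict (Ioi 0)) :=
    (m1 _ (hwm (ξ - η))).mul (m1 _ (hwm ξ))
  have mB : AEMeasurable (fun y => (‖deriv (w (ξ - η)) y‖ₑ * ENNReal.ofReal (rho ε t y)) *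
      (‖w ξ y‖ₑ * ENNReal.ofReal (rho ε t y))) ((volume : Measure ℝ).restrict (Ioi 0)) :=
    (m1 _ (hdm (ξ - η))).mul (m1 _ (hwm ξ))
  calc _ ≤ ∫⁻ y in Ioi (0 : ℝ), ((ENNReal.ofReal (|ξ - η| * W) * S1) *
        ((‖w (ξ - η) y‖ₑ * ENNReal.ofReal (rho ε t y)) *
          (‖w ξ y‖ₑ * ENNReal.ofReal (rho ε t y))) +
        (ENNReal.ofReal (|η| * W) * S2) *
        ((‖deriv (w (ξ - η)) y‖ₑ * ENNReal.ofReal (rho ε t y)) *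
          (‖w ξ y‖ₑ * ENNReal.ofReal (rho ε t y)))) := by
        apply setLIntegral_mono_ae' measurableSet_Ioi
        refine Eventually.of_forall fun y hy => ?_
        have hy0 : (0 : ℝ) ≤ y := le_of_lt hy
        have eW : ‖((wgt ε t τ r ξ y : ℝ) : ℂ)‖ₑ =
            ENNReal.ofReal W * (ENNReal.ofReal (rho ε t y) * ENNReal.ofReal (rho ε t y)) := by
          have hρ := rho_pos ε t y
          rw [← ENNReal.ofReal_mul hρ.le, ← ENNReal.ofReal_mul hW0, ← ofReal_norm,
            Complex.norm_real, Real.norm_eq_abs, abs_of_nonneg (by unfold wgt; positivity)]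
          congr 1; unfold wgt; rw [hW]; ring
        have eR : ∀ x : ℝ, ‖(x : ℂ)‖ₑ = ENNReal.ofReal |x| := fun x => by
          rw [← ofReal_norm, Complex.norm_real, Real.norm_eq_abs]
        rw [enorm_mul, enorm_mul, eW, RCLike.enorm_conj, ENNReal.ofReal_mul (abs_nonneg _),
          ENNReal.ofReal_mul (abs_nonneg _)]
        calc _ ≤ (‖w η y * ((ξ - η : ℝ) : ℂ) * w (ξ - η) y‖ₑ
            + ‖(η : ℂ) * Iy (w η) y * deriv (w (ξ - η)) y‖ₑ) * ‖w ξ y‖ₑ * (ENNReal.ofReal W *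
              (ENNReal.ofReal (rho ε t y) * ENNReal.ofReal (rho ε t y))) := by
              gcongr; exact enorm_sub_le
          _ ≤ (S1 * ENNReal.ofReal |ξ - η| * ‖w (ξ - η) y‖ₑ
            + ENNReal.ofReal |η| * S2 * ‖deriv (w (ξ - η)) y‖ₑ) * ‖w ξ y‖ₑ * (ENNReal.ofReal W *
              (ENNReal.ofReal (rho ε t y) * ENNReal.ofReal (rho ε t y))) := by
              rw [enorm_mul, enorm_mul, enorm_mul, enorm_mul, eR, eR]
              gcongr
              · exact hb1 y hy0
              · exact hb2 y hy0
          _ = _ := by ring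
    _ = (ENNReal.ofReal (|ξ - η| * W) * S1) * (∫⁻ y in Ioi (0 : ℝ),
        ((‖w (ξ - η) y‖ₑ * ENNReal.ofReal (rho ε t y)) *
          (‖w ξ y‖ₑ * ENNReal.ofReal (rho ε t y)))) +
        (ENNReal.ofReal (|η| * W) * S2) * ∫⁻ y in Ioi (0 : ℝ),
        ((‖deriv (w (ξ - η)) y‖ₑ * ENNReal.ofReal (rho ε t y)) *
          (‖w ξ y‖ₑ * ENNReal.ofReal (rho ε t y))) := by
        rw [lintegral_add_left' (mA.const_mul _), lintegral_const_mul'' _ mA,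
          lintegral_const_mul'' _ mB]
    _ ≤ (ENNReal.ofReal (|ξ - η| * W) * S1) * (nrm ε t (w (ξ - η)) * nrm ε t (w ξ)) +
        (ENNReal.ofReal (|η| * W) * S2) *
          (nrm ε t (fun y => deriv (w (ξ - η)) y) * nrm ε t (w ξ)) := by
        unfold nrm
        gcongr
    _ = _ := by rw [hS1, hS2]; ring

lemma Hk_int (ε t τ r : ℝ) (w : ℝ → ℝ → ℂ)
    (f1 : wFinite ε t τ r (fun ξ => |ξ|) w) (f2 : wFinite ε t τ r brak w)
    (f3 : wFinite ε t τ r (fun _ => 1) (fun ξ y => deriv (w ξ) y)) :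
    ∫⁻ ξ : ℝ, ∫⁻ η : ℝ, (Hk ε t τ r w ξ η + Hk ε t τ r w ξ (ξ - η)) ≤
      4 * l2 volume (jw r) * (ENNReal.ofReal (wNorm ε t τ r (fun ξ => |ξ|) w) *
        ENNReal.ofReal (wNorm ε t τ r brak w) *
        ENNReal.ofReal (wNorm ε t τ r (fun _ => 1) (fun ξ y => deriv (w ξ) y))) := by
  obtain ⟨mp, lp⟩ := wfin ε t τ r _ (fun ξ => abs_nonneg ξ) w f1
  obtain ⟨mq, lq⟩ := wfin ε t τ r _ (fun ξ => (brak_pos ξ).le) w f2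
  obtain ⟨mg, lg⟩ := wfin ε t τ r _ (fun ξ => zero_le_one) _ f3
  have mj := (jw_meas r).aemeasurable (μ := (volume : Measure ℝ))
  rw [← lp, ← lq, ← lg]
  set p := fun ξ => pm ε t τ r ξ |ξ| (w ξ) with hp
  set q := fun ξ => pm ε t τ r ξ (brak ξ) (w ξ) with hq
  set g := fun ξ => pm ε t τ r ξ 1 (fun y => deriv (w ξ) y) with hg
  have eH : ∀ ξ η, Hk ε t τ r w ξ η =
      (jw r η * p η) * g (ξ - η) * q ξ + p η * (jw r (ξ - η) * g (ξ - η)) * q ξ := by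
    intro ξ η
    simp only [Hk, hp, hq, hg]; ring
  have hjp : ∫⁻ η, jw r η * p η ≤ l2 volume (jw r) * l2 volume p := cs _ mj mp
  have hjg : ∫⁻ η, jw r η * g η ≤ l2 volume (jw r) * l2 volume g := cs _ mj mg
  have sh : ∀ (ξ : ℝ) (f : ℝ → ENNReal), AEMeasurable f volume →
      AEMeasurable (fun η => f (ξ - η)) volume := fun ξ f hf =>
    hf.comp_quasiMeasurePreserving (Measure.measurePreserving_sub_left volume ξ).quasiMeasurePreserving
  have c1 := conv_le (f := fun η => jw r η * p η) (mj.mul mp) mg mq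
  have c2 := conv_le (f := fun η => jw r η * g η) (mj.mul mg) mp mq
  have sw : ∀ ξ, ∫⁻ η, p η * (jw r (ξ - η) * g (ξ - η)) * q ξ =
      ∫⁻ η, (jw r η * g η) * p (ξ - η) * q ξ := by
    intro ξ
    rw [← lintegral_sub_left_eq_self _ ξ]
    apply lintegral_congr
    intro η
    simp only [sub_sub_cancel]; ring
  have mH : ∀ ξ, AEMeasurable (fun η => Hk ε t τ r w ξ η) volume := by
    intro ξ
    simp_rw [eH]
    exact (((mj.mul mp).mul (sh ξ g mg)).mul_const _).add
      ((mp.mul ((sh ξ _ mj).mul (sh ξ g mg))).mul_const _)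
  have m2 : AEMeasurable (fun ξ => ∫⁻ η, (jw r η * p η) * g (ξ - η) * q ξ) volume := by
    have hq' := quasiMeasurePreserving_sub_of_right_invariant (volume : Measure ℝ)
      (volume : Measure ℝ)
    have hg2 : AEMeasurable (fun p : ℝ × ℝ => g (p.1 - p.2)) (volume.prod volume) :=
      mg.comp_quasiMeasurePreserving hq'
    have : AEMeasurable (fun z : ℝ × ℝ => (jw r z.2 * p z.2) * g (z.1 - z.2) * q z.1)
        (volume.prod volume) := ((mj.mul mp).comp_snd.mul hg2).mul mq.comp_fst
    exact this.lintegral_prod_right'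
  have h1 : ∀ ξ, ∫⁻ η : ℝ, (Hk ε t τ r w ξ η + Hk ε t τ r w ξ (ξ - η)) =
      2 * ((∫⁻ η, (jw r η * p η) * g (ξ - η) * q ξ) +
        ∫⁻ η, (jw r η * g η) * p (ξ - η) * q ξ) := by
    intro ξ
    rw [lintegral_add_left' (mH ξ), lintegral_sub_left_eq_self (fun η => Hk ε t τ r w ξ η), ← two_mul]
    congr 1
    simp_rw [eH]
    have m3 : AEMeasurable (fun η => (jw r η * p η) * g (ξ - η) * q ξ) volume :=
      ((mj.mul mp).mul (sh ξ g mg)).mul_const _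
    rw [lintegral_add_left' m3, sw]
  simp_rw [h1]
  rw [lintegral_const_mul' _ _ (by norm_num), lintegral_add_left' m2]
  calc _ ≤ 2 * ((l2 volume (jw r) * l2 volume p) * (l2 volume g * l2 volume q) +
        (l2 volume (jw r) * l2 volume g) * (l2 volume p * l2 volume q)) := by
        gcongr
        · exact c1.trans (by gcongr)
        · exact c2.trans (by gcongr)
    _ = _ := by ring

/-- **Bound (3.17a) of the paper** on `T_𝒩 = ∫∫ 𝒩_ξ conj(w̄_ξ) ρ² e^{2τ|ξ|}⟨ξ⟩^{2r} dy dξ`: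
`|T_𝒩| ≤ C ‖|∂ₓ|^{1/2} w̄‖_{τ,r} ‖⟨∂ₓ⟩^{1/2} w̄‖_{τ,r} ‖∂_y w̄‖_{τ,r}` with `C = C(r)`. -/
theorem TN_bound :
    ∀ r : ℝ, 2 < r →
    ∃ C : ℝ, 0 < C ∧
    ∀ (ε t τ : ℝ), 0 < ε → ε ≤ 1 → 0 ≤ t → t ≤ ε → 0 < τ →
    ∀ w : ℝ → ℝ → ℂ,
      (∀ ξ : ℝ, ContDiffOn ℝ 1 (w ξ) (Ici 0)) →
      (∀ ξ : ℝ, w ξ 0 = 0) →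
      wFinite ε t τ r (fun ξ => |ξ|) w →
      wFinite ε t τ r brak w →
      wFinite ε t τ r (fun _ => 1) (fun ξ y => deriv (w ξ) y) →
      Integrable (fun q : ℝ × ℝ × ℝ =>
        (w q.2.1 q.2.2 * ((q.1 - q.2.1 : ℝ) : ℂ) * w (q.1 - q.2.1) q.2.2
            - (q.2.1 : ℂ) * Iy (w q.2.1) q.2.2 * deriv (w (q.1 - q.2.1)) q.2.2) *
          (starRingEnd ℂ) (w q.1 q.2.2) * ((wgt ε t τ r q.1 q.2.2 : ℝ) : ℂ))
        ((volume : Measure ℝ).prod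
          ((volume : Measure ℝ).prod ((volume : Measure ℝ).restrict (Ioi 0)))) →
      ‖∫ ξ : ℝ, ∫ y in Ioi (0 : ℝ),
          Ncal w ξ y * (starRingEnd ℂ) (w ξ y) * ((wgt ε t τ r ξ y : ℝ) : ℂ)‖
        ≤ C * wNorm ε t τ r (fun ξ => |ξ|) w * wNorm ε t τ r brak w *
            wNorm ε t τ r (fun _ => 1) (fun ξ y => deriv (w ξ) y) := by
  intro r hr
  set K : ENNReal := kG * ENNReal.ofReal (2 ^ r * 2) * (4 * l2 volume (jw r)) with hK
  have hKt : K ≠ ⊤ := by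
    have h1 := kG_lt_top.ne
    have h2 := (jw_l2 r hr).ne
    rw [hK]; finiteness
  refine ⟨K.toReal + 1, by positivity, ?_⟩
  intro ε t τ hε _ ht hte hτ w hw h0 f1 f2 f3 hF
  set P := wNorm ε t τ r (fun ξ => |ξ|) w with hP
  set Q := wNorm ε t τ r brak w with hQ
  set G := wNorm ε t τ r (fun _ => 1) (fun ξ y => deriv (w ξ) y) with hG
  have hP0 : 0 ≤ P := Real.sqrt_nonneg _
  have hQ0 : 0 ≤ Q := Real.sqrt_nonneg _
  have hG0 : 0 ≤ G := Real.sqrt_nonneg _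
  suffices hs : ‖∫ ξ : ℝ, ∫ y in Ioi (0 : ℝ),
          Ncal w ξ y * (starRingEnd ℂ) (w ξ y) * ((wgt ε t τ r ξ y : ℝ) : ℂ)‖ₑ ≤
      K * (ENNReal.ofReal P * ENNReal.ofReal Q * ENNReal.ofReal G) by
    rw [← ENNReal.ofReal_toReal hKt, ← ENNReal.ofReal_mul hP0, ← ENNReal.ofReal_mul (by positivity),
      ← ENNReal.ofReal_mul (by positivity), ← ofReal_norm,
      ENNReal.ofReal_le_ofReal_iff (by positivity)] at hs
    refine hs.trans ?_
    have : 0 ≤ P * Q * G := by positivity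
    nlinarith
  calc _ ≤ ∫⁻ ξ : ℝ, ‖∫ y in Ioi (0 : ℝ),
          Ncal w ξ y * (starRingEnd ℂ) (w ξ y) * ((wgt ε t τ r ξ y : ℝ) : ℂ)‖ₑ :=
        enorm_integral_le_lintegral_enorm _
    _ ≤ ∫⁻ ξ : ℝ, ∫⁻ η : ℝ, kG * ENNReal.ofReal (2 ^ r * 2) *
          (Hk ε t τ r w ξ η + Hk ε t τ r w ξ (ξ - η)) := by
        apply lintegral_mono_ae
        filter_upwards [hF.aestronglyMeasurable.prodMk_left] with ξ hξ
        calc _ ≤ ∫⁻ y in Ioi (0 : ℝ), ‖Ncal w ξ y * (starRingEnd ℂ) (w ξ y) *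
              ((wgt ε t τ r ξ y : ℝ) : ℂ)‖ₑ := enorm_integral_le_lintegral_enorm _
          _ ≤ ∫⁻ y in Ioi (0 : ℝ), ∫⁻ η : ℝ, ‖(w η y * ((ξ - η : ℝ) : ℂ) * w (ξ - η) y
              - (η : ℂ) * Iy (w η) y * deriv (w (ξ - η)) y) *
              (starRingEnd ℂ) (w ξ y) * ((wgt ε t τ r ξ y : ℝ) : ℂ)‖ₑ := by
              apply lintegral_mono
              intro y
              simp only [enorm_mul _ ((wgt ε t τ r ξ y : ℝ) : ℂ),
                enorm_mul _ ((starRingEnd ℂ) (w ξ y))]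
              rw [lintegral_mul_const' _ _ enorm_ne_top, lintegral_mul_const' _ _ enorm_ne_top]
              gcongr
              unfold Ncal
              rw [enorm_mul]
              have hI : ‖Complex.I‖ₑ = 1 := by rw [← ofReal_norm]; simp
              rw [hI, one_mul]
              exact enorm_integral_le_lintegral_enorm _
          _ = ∫⁻ η : ℝ, ∫⁻ y in Ioi (0 : ℝ), ‖(w η y * ((ξ - η : ℝ) : ℂ) * w (ξ - η) y
              - (η : ℂ) * Iy (w η) y * deriv (w (ξ - η)) y) *
              (starRingEnd ℂ) (w ξ y) * ((wgt ε t τ r ξ y : ℝ) : ℂ)‖ₑ := by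
              symm
              apply lintegral_lintegral_swap
              exact hξ.enorm
          _ ≤ _ := by
              apply lintegral_mono
              intro η
              refine (yint ε t τ r hε ht hte w hw h0 ξ η).trans ?_
              have k1 := kerE ε t τ r hr hτ w ξ η
              have k2 := kerE ε t τ r hr hτ w ξ (ξ - η)
              rw [sub_sub_cancel] at k2
              calc _ ≤ kG * (ENNReal.ofReal (2 ^ r * 2) * Hk ε t τ r w ξ (ξ - η)) +
                    kG * (ENNReal.ofReal (2 ^ r * 2) * Hk ε t τ r w ξ η) := by gcongr
                _ = _ := by ring
    _ = kG * ENNReal.ofReal (2 ^ r * 2) * ∫⁻ ξ : ℝ, ∫⁻ η : ℝ,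
          (Hk ε t τ r w ξ η + Hk ε t τ r w ξ (ξ - η)) := by
        have hk : kG * ENNReal.ofReal (2 ^ r * 2) ≠ ⊤ := by
          have h1 := kG_lt_top.ne
          finiteness
        simp_rw [lintegral_const_mul' _ _ hk]
    _ ≤ kG * ENNReal.ofReal (2 ^ r * 2) * (4 * l2 volume (jw r) *
          (ENNReal.ofReal P * ENNReal.ofReal Q * ENNReal.ofReal G)) := by
        gcongr
        exact Hk_int ε t τ r w f1 f2 f3
    _ = _ := by rw [hK]; ring
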